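/- arXiv:2203.02997 — 3 statements merged into one kernel-verified Lean document; each statement's English description precedes it below -/
import Mathlib

section
/- Let N = 2K+1, let y : ZMod N → ℝ with cyclic autocorrelation r_t = Σ_n y_n y_{n+t}, and let R be the N×N matrix with entries R(i,j) = r_{j−i}. For any weight vector w in the probability simplex (w_k ≥ 0, Σ_k w_k = 1), the smoothing objective G(w) = Σ_{n=1}^{N} Σ_{k=-K}^{K} w_k (y_{n+k} − Σ_{m=-K}^{K} w_m y_{n+m})² satisfies G(w) = r_0 − wᵀRw. Consequently, minimizing G over any subset of the simplex is equivalent to maximizing the quadratic form wᵀRw over that subset. -/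
/-- The variance identity for a finitely supported weight of total mass one. -/
theorem sum_weight_mul_sub_sq {ι R : Type*} [Fintype ι] [CommRing R] (w f : ι → R)
    (hw : ∑ k, w k = 1) :
    ∑ k, w k * (f k - ∑ m, w m * f m) ^ 2 = ∑ k, w k * f k ^ 2 - (∑ m, w m * f m) ^ 2 := by
  set a := ∑ m, w m * f m with ha
  have h : ∀ k, w k * (f k - a) ^ 2 = w k * f k ^ 2 - 2 * a * (w k * f k) + a ^ 2 * w k :=
    fun k => by ring
  simp_rw [h, Finset.sum_add_distrib, Finset.sum_sub_distrib, ← Finset.mul_sum, ← ha, hw]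
  ring

/-- Translation invariance of the autocorrelation on a finite commutative group. -/
theorem sum_translate_mul_translate {A R : Type*} [Fintype A] [AddCommGroup A] [CommRing R]
    (y : A → R) (i j : A) :
    ∑ n, y (n + i) * y (n + j) = ∑ n, y n * y (n + (j - i)) := by
  rw [← Equiv.sum_comp (Equiv.addRight i) (fun n => y n * y (n + (j - i)))]
  simp [add_assoc]

/-- The total weighted variance of the translates of `y` is the autocorrelation at zero minus
the quadratic form of the autocorrelation matrix. -/
theorem sum_sum_weight_mul_sub_sq {A R : Type*} [Fintype A] [AddCommGroup A] [CommRing R]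
    (y w : A → R) (hw : ∑ k, w k = 1) :
    ∑ n, ∑ k, w k * (y (n + k) - ∑ m, w m * y (n + m)) ^ 2 =
      ∑ n, y n * y (n + 0) - ∑ i, ∑ j, w i * w j * ∑ n, y n * y (n + (j - i)) := by
  have h₁ : ∑ n, ∑ k, w k * y (n + k) ^ 2 = ∑ n, y n * y (n + 0) := by
    rw [Finset.sum_comm]
    simp_rw [← Finset.mul_sum, pow_two, sum_translate_mul_translate, sub_self,
      ← Finset.sum_mul, hw, one_mul]
  have h₂ : ∑ n, (∑ m, w m * y (n + m)) ^ 2 =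
      ∑ i, ∑ j, w i * w j * ∑ n, y n * y (n + (j - i)) := by
    simp_rw [← sum_translate_mul_translate, pow_two, Finset.sum_mul_sum, Finset.mul_sum]
    rw [Finset.sum_comm]
    refine Finset.sum_congr rfl fun i _ => ?_
    rw [Finset.sum_comm]
    exact Finset.sum_congr rfl fun j _ => Finset.sum_congr rfl fun n _ => by ring
  rw [← h₁, ← h₂, ← Finset.sum_sub_distrib]
  exact Finset.sum_congr rfl fun n _ => sum_weight_mul_sub_sq w (fun k => y (n + k)) hw


/-- for any weight vector `w` in the probability simplex, the smoothing
objective `G w = ∑ n ∑ k w k (y (n+k) - ∑ m w m y (n+m))²` satisfies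
`G w = r 0 - wᵀRw`, where `R (i, j) = r (j - i)` is the autocorrelation matrix; hence
minimizing `G` over any subset of the simplex is equivalent to maximizing `wᵀRw` there. -/
theorem smoothing_objective_eq_r0_sub_quadform
    (K : ℕ) (y : ZMod (2 * K + 1) → ℝ) (r : ZMod (2 * K + 1) → ℝ)
    (hr : ∀ t, r t = ∑ n, y n * y (n + t))
    (G : (ZMod (2 * K + 1) → ℝ) → ℝ)
    (hG : ∀ w, G w = ∑ n, ∑ k, w k * (y (n + k) - ∑ m, w m * y (n + m)) ^ 2) :
    (∀ w : ZMod (2 * K + 1) → ℝ, (∀ k, 0 ≤ w k) → (∑ k, w k = 1) →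
      G w = r 0 - ∑ i, ∑ j, w i * w j * r (j - i)) ∧
    (∀ W : Set (ZMod (2 * K + 1) → ℝ),
      (∀ w ∈ W, (∀ k, 0 ≤ w k) ∧ (∑ k, w k = 1)) →
      ∀ w₀ ∈ W,
        ((∀ w ∈ W, G w₀ ≤ G w) ↔
          (∀ w ∈ W, ∑ i, ∑ j, w i * w j * r (j - i) ≤
            ∑ i, ∑ j, w₀ i * w₀ j * r (j - i)))) := by
  have key : ∀ w : ZMod (2 * K + 1) → ℝ, (∑ k, w k = 1) →
      G w = r 0 - ∑ i, ∑ j, w i * w j * r (j - i) := fun w hw => by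
    simp_rw [hG, hr]
    exact sum_sum_weight_mul_sub_sq y w hw
  refine ⟨fun w _ hw => key w hw, fun W hW w₀ hw₀ => forall₂_congr fun w hw => ?_⟩
  rw [key w₀ (hW w₀ hw₀).2, key w (hW w hw).2, sub_le_sub_iff_left]
end

section
/- Fix K ≥ 1 and ε ≥ 0. Let W_symm be the set of weight vectors w = (w_{−K},…,w_K) in the probability simplex satisfying w_0 = (1+ε)w_1, w_k = w_{−k} for all k, and w_k ≥ w_{k+1} for k ≥ 1. For i ∈ {1,…,K} define the vertex v_i by v_{i,0} = (1+ε)/(2i+1+ε), v_{i,k} = 1/(2i+1+ε) for 1 ≤ |k| ≤ i, and v_{i,k} = 0 otherwise. Then every w ∈ W_symm is a convex combination of the v_i: setting p_i = (w_i − w_{i+1})(2i+1+ε) for 1 ≤ i ≤ K (with the convention w_{K+1} = 0), one has p_i ≥ 0, Σ_{i=1}^{K} p_i = 1, and w = Σ_{i=1}^{K} p_i v_i. Hence W_symm is the convex hull of {v_1,…,v_K}. -/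
/-- The vertex window `v_i` (tapered-rectangle vertex with parameter `ε`):
`v_{i,0} = (1+ε)/(2i+1+ε)`, `v_{i,k} = 1/(2i+1+ε)` for `1 ≤ |k| ≤ i`, and `0` otherwise. -/
noncomputable def tapVertex (ε : ℝ) (i k : ℤ) : ℝ :=
  if k = 0 then (1 + ε) / (2 * (i : ℝ) + 1 + ε)
  else if |k| ≤ i then 1 / (2 * (i : ℝ) + 1 + ε) else 0

/-- The set `W_symm` of symmetric window weights with parameter `ε`: weight vectors
indexed by `k ∈ {-K, …, K}` (zero outside), in the probability simplex, with
`w 0 = (1+ε) w 1`, symmetric `w (-k) = w k`, and nonincreasing away from the center. -/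
def WSymm (K : ℕ) (ε : ℝ) : Set (ℤ → ℝ) :=
  {w | (∀ k, 0 ≤ w k) ∧ (∀ k : ℤ, (K : ℤ) < |k| → w k = 0) ∧
       (∑ k ∈ Finset.Icc (-(K : ℤ)) (K : ℤ), w k = 1) ∧
       (w 0 = (1 + ε) * w 1) ∧ (∀ k : ℤ, w (-k) = w k) ∧
       (∀ k : ℤ, 1 ≤ k → w (k + 1) ≤ w k)}

theorem Int.sum_Icc_one_natCast_succ {M : Type*} [AddCommMonoid M] (f : ℤ → M) (n : ℕ) :
    ∑ i ∈ Finset.Icc (1 : ℤ) ((n + 1 : ℕ) : ℤ), f i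
      = ∑ i ∈ Finset.Icc (1 : ℤ) (n : ℤ), f i + f ((n : ℤ) + 1) := by
  have h : Finset.Icc (1 : ℤ) ((n + 1 : ℕ) : ℤ)
      = insert ((n : ℤ) + 1) (Finset.Icc (1 : ℤ) (n : ℤ)) := by
    ext x
    simp only [Finset.mem_Icc, Finset.mem_insert]
    omega
  rw [h, Finset.sum_insert (by simp), add_comm]

theorem Int.sum_Icc_neg_natCast {M : Type*} [AddCommMonoid M] (f : ℤ → M) (n : ℕ) :
    ∑ k ∈ Finset.Icc (-(n : ℤ)) (n : ℤ), f k
      = f 0 + ∑ i ∈ Finset.Icc (1 : ℤ) (n : ℤ), (f i + f (-i)) := by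
  induction n with
  | zero => simp
  | succ n ih =>
    have h : Finset.Icc (-((n + 1 : ℕ) : ℤ)) ((n + 1 : ℕ) : ℤ)
        = insert ((n : ℤ) + 1) (insert (-((n : ℤ) + 1)) (Finset.Icc (-(n : ℤ)) (n : ℤ))) := by
      ext x
      simp only [Finset.mem_Icc, Finset.mem_insert]
      omega
    rw [Int.sum_Icc_one_natCast_succ, h, Finset.sum_insert, Finset.sum_insert, ih]
    · abel
    all_goals
      simp only [Finset.mem_Icc, Finset.mem_insert]
      omega

/-- Summation by parts for the coefficients of the vertex decomposition. -/
theorem sum_sub_succ_mul_affine (w : ℤ → ℝ) (ε : ℝ) (n : ℕ) :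
    ∑ i ∈ Finset.Icc (1 : ℤ) (n : ℤ), (w i - w (i + 1)) * (2 * (i : ℝ) + 1 + ε)
      = (1 + ε) * w 1 + ∑ i ∈ Finset.Icc (1 : ℤ) (n : ℤ), (w i + w i)
        - (2 * (n : ℝ) + 1 + ε) * w ((n : ℤ) + 1) := by
  induction n with
  | zero => simp
  | succ n ih =>
    rw [Int.sum_Icc_one_natCast_succ, Int.sum_Icc_one_natCast_succ, ih]
    push_cast
    ring

theorem sum_ite_le_sub_succ (w : ℤ → ℝ) {m : ℤ} (hm : 1 ≤ m) (n : ℕ) :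
    ∑ i ∈ Finset.Icc (1 : ℤ) (n : ℤ), (if m ≤ i then w i - w (i + 1) else 0)
      = if m ≤ n then w m - w ((n : ℤ) + 1) else 0 := by
  induction n with
  | zero => simp [show ¬ m ≤ 0 by omega]
  | succ n ih =>
    rw [Int.sum_Icc_one_natCast_succ, ih]
    push_cast
    rcases lt_trichotomy m ((n : ℤ) + 1) with h | h | h
    · rw [if_pos (by omega), if_pos (by omega), if_pos (by omega)]
      ring
    · subst h
      simp
    · rw [if_neg (by omega), if_neg (by omega), if_neg (by omega), add_zero]

theorem sum_Icc_one_ite_le (c : ℝ) (i n : ℕ) :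
    ∑ k ∈ Finset.Icc (1 : ℤ) (n : ℤ), (if k ≤ (i : ℤ) then c else 0) = (min n i : ℕ) * c := by
  induction n with
  | zero => simp
  | succ n ih =>
    rw [Int.sum_Icc_one_natCast_succ, ih]
    rcases le_or_gt (n + 1) i with h | h
    · rw [if_pos (by omega), min_eq_left (by omega), min_eq_left h]
      push_cast
      ring
    · rw [if_neg (by omega), min_eq_right (by omega), min_eq_right (by omega), add_zero]

theorem mul_tapVertex {ε : ℝ} (hε : 0 ≤ ε) {i : ℤ} (hi : 1 ≤ i) (a : ℝ) (k : ℤ) :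
    a * (2 * (i : ℝ) + 1 + ε) * tapVertex ε i k
      = if k = 0 then (1 + ε) * a else if |k| ≤ i then a else 0 := by
  have hi' : (1 : ℝ) ≤ i := by exact_mod_cast hi
  have hpos : 2 * (i : ℝ) + 1 + ε ≠ 0 := by positivity
  unfold tapVertex
  split_ifs
  · field_simp
  · field_simp
  · simp

theorem tapVertex_mem_WSymm {K : ℕ} {ε : ℝ} (hε : 0 ≤ ε) {i : ℤ} (hi : i ∈ Set.Icc (1 : ℤ) K) :
    tapVertex ε i ∈ WSymm K ε := by
  obtain ⟨h1, hiK⟩ := hi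
  have hi' : (1 : ℝ) ≤ i := by exact_mod_cast h1
  have hpos : 0 < 2 * (i : ℝ) + 1 + ε := by positivity
  refine ⟨fun k => ?_, fun k hk => ?_, ?_, ?_, fun k => ?_, fun k hk => ?_⟩
  · unfold tapVertex
    split_ifs <;> positivity
  · have hk0 : k ≠ 0 := by
      rintro rfl
      simp at hk
      omega
    rw [tapVertex, if_neg hk0, if_neg (by omega)]
  · lift i to ℕ using by omega
    rw [Int.sum_Icc_neg_natCast]
    have h : ∀ k ∈ Finset.Icc (1 : ℤ) (K : ℤ), tapVertex ε i k + tapVertex ε i (-k)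
        = if k ≤ (i : ℤ) then 2 / (2 * ((i : ℤ) : ℝ) + 1 + ε) else 0 := by
      intro k hk
      have hk1 := (Finset.mem_Icc.mp hk).1
      simp only [tapVertex, neg_eq_zero, abs_neg, abs_of_nonneg (show 0 ≤ k by omega),
        if_neg (show k ≠ 0 by omega)]
      split_ifs <;> ring
    rw [Finset.sum_congr rfl h, sum_Icc_one_ite_le, min_eq_right (by omega), tapVertex, if_pos rfl]
    push_cast at hpos ⊢
    field_simp
    ring
  · simp only [tapVertex, if_true, one_ne_zero, if_false, abs_one, if_pos h1]
    ring
  · simp [tapVertex]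
  · simp only [tapVertex, if_neg (show k ≠ 0 by omega), if_neg (show k + 1 ≠ 0 by omega),
      abs_of_nonneg (show 0 ≤ k by omega), abs_of_nonneg (show 0 ≤ k + 1 by omega)]
    split_ifs
    · exact le_rfl
    · omega
    · positivity
    · exact le_rfl

theorem convex_WSymm (K : ℕ) (ε : ℝ) : Convex ℝ (WSymm K ε) := by
  rintro x ⟨hx0, hxK, hx1, hxc, hxs, hxm⟩ y ⟨hy0, hyK, hy1, hyc, hys, hym⟩ a b ha hb hab
  refine ⟨fun k => ?_, fun k hk => ?_, ?_, ?_, fun k => ?_, fun k hk => ?_⟩ <;>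
    simp only [Pi.add_apply, Pi.smul_apply, smul_eq_mul]
  · exact add_nonneg (mul_nonneg ha (hx0 k)) (mul_nonneg hb (hy0 k))
  · rw [hxK k hk, hyK k hk, mul_zero, mul_zero, add_zero]
  · rw [Finset.sum_add_distrib, ← Finset.mul_sum, ← Finset.mul_sum, hx1, hy1, mul_one, mul_one, hab]
  · rw [hxc, hyc]
    ring
  · rw [hxs, hys]
  · exact add_le_add (mul_le_mul_of_nonneg_left (hxm k hk) ha)
      (mul_le_mul_of_nonneg_left (hym k hk) hb)

theorem sum_coeff_eq_one_of_mem_WSymm {K : ℕ} {ε : ℝ} {w : ℤ → ℝ} (hw : w ∈ WSymm K ε) :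
    ∑ i ∈ Finset.Icc (1 : ℤ) (K : ℤ), (w i - w (i + 1)) * (2 * (i : ℝ) + 1 + ε) = 1 := by
  obtain ⟨-, hK, h1, hc, hs, -⟩ := hw
  rw [Int.sum_Icc_neg_natCast] at h1
  simp only [hs] at h1
  rw [sum_sub_succ_mul_affine, ← hc, h1, hK _ (by rw [abs_of_nonneg] <;> omega)]
  ring

theorem eq_sum_tapVertex_of_mem_WSymm {K : ℕ} (hK : 1 ≤ K) {ε : ℝ} (hε : 0 ≤ ε) {w : ℤ → ℝ}
    (hw : w ∈ WSymm K ε) (k : ℤ) :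
    w k = ∑ i ∈ Finset.Icc (1 : ℤ) (K : ℤ),
      (w i - w (i + 1)) * (2 * (i : ℝ) + 1 + ε) * tapVertex ε i k := by
  obtain ⟨-, hz, -, hc, hs, -⟩ := hw
  have hlast : w ((K : ℤ) + 1) = 0 := hz _ (by rw [abs_of_nonneg] <;> omega)
  rw [Finset.sum_congr rfl fun i hi => mul_tapVertex hε (Finset.mem_Icc.mp hi).1 _ k]
  by_cases hk : k = 0
  · subst hk
    have h := sum_ite_le_sub_succ w le_rfl K
    rw [Finset.sum_congr rfl fun i hi => if_pos (Finset.mem_Icc.mp hi).1,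
      if_pos (by exact_mod_cast hK), hlast, sub_zero] at h
    simp only [if_true]
    rw [← Finset.mul_sum, h, hc]
  · have hwabs : w |k| = w k := by
      rcases abs_choice k with h | h <;> rw [h]
      exact hs k
    simp only [if_neg hk]
    rw [sum_ite_le_sub_succ w (Int.one_le_abs hk), hlast, sub_zero, hwabs]
    split_ifs with h
    · rfl
    · exact hz k (not_le.mp h)

/-- every `w ∈ W_symm` is the convex combination of the vertices
`v_1, …, v_K` with coefficients `p_i = (w_i - w_{i+1}) (2i+1+ε)`; these coefficients are
nonnegative and sum to `1`. Hence `W_symm` is the convex hull of `{v_1, …, v_K}`. -/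
theorem WSymm_is_convex_hull_of_vertices
    (K : ℕ) (hK : 1 ≤ K) (ε : ℝ) (hε : 0 ≤ ε) :
    (∀ w ∈ WSymm K ε,
      (∀ i ∈ Finset.Icc (1 : ℤ) (K : ℤ),
        0 ≤ (w i - w (i + 1)) * (2 * (i : ℝ) + 1 + ε)) ∧
      (∑ i ∈ Finset.Icc (1 : ℤ) (K : ℤ),
        (w i - w (i + 1)) * (2 * (i : ℝ) + 1 + ε) = 1) ∧
      (∀ k : ℤ, w k = ∑ i ∈ Finset.Icc (1 : ℤ) (K : ℤ),
        (w i - w (i + 1)) * (2 * (i : ℝ) + 1 + ε) * tapVertex ε i k)) ∧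
    WSymm K ε = convexHull ℝ ((fun i => tapVertex ε i) '' Set.Icc (1 : ℤ) (K : ℤ)) := by
  have hnonneg : ∀ w ∈ WSymm K ε, ∀ i ∈ Finset.Icc (1 : ℤ) (K : ℤ),
      0 ≤ (w i - w (i + 1)) * (2 * (i : ℝ) + 1 + ε) := by
    intro w hw i hi
    have h1 := (Finset.mem_Icc.mp hi).1
    have hi' : (1 : ℝ) ≤ i := by exact_mod_cast h1
    exact mul_nonneg (sub_nonneg.mpr (hw.2.2.2.2.2 i h1)) (by positivity)
  refine ⟨fun w hw => ⟨hnonneg w hw, sum_coeff_eq_one_of_mem_WSymm hw,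
    eq_sum_tapVertex_of_mem_WSymm hK hε hw⟩, Set.Subset.antisymm (fun w hw => ?_) ?_⟩
  · have hsum : w = ∑ i ∈ Finset.Icc (1 : ℤ) (K : ℤ),
        ((w i - w (i + 1)) * (2 * (i : ℝ) + 1 + ε)) • tapVertex ε i := by
      ext k
      simpa [Finset.sum_apply] using eq_sum_tapVertex_of_mem_WSymm hK hε hw k
    rw [hsum]
    exact (convex_convexHull ℝ _).sum_mem (hnonneg w hw) (sum_coeff_eq_one_of_mem_WSymm hw)
      fun i hi => subset_convexHull ℝ _ ⟨i, Finset.mem_Icc.mp hi, rfl⟩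
  · refine convexHull_min ?_ (convex_WSymm K ε)
    rintro _ ⟨i, hi, rfl⟩
    exact tapVertex_mem_WSymm hε hi
end

section
/- Let N = 2K+1, y : ZMod N → ℝ, and let R be the circulant autocorrelation matrix R(i,j) = r_{j−i} with r_t = Σ_n y_n y_{n+t}. Let W_symm (with ε = 0) be the set of tapered rectangle windows: weight vectors w in the probability simplex with w_{−1} = w_0 = w_1, w_k = w_{−k} for all k, and w_k ≥ w_{k+1} for k ≥ 1. Then there exists i ∈ {1,…,K} such that the unweighted (uniform) moving-average window u_i of odd length 2i+1 ≥ 3, defined by u_{i,k} = 1/(2i+1) for |k| ≤ i and 0 otherwise, satisfies u_iᵀ R u_i ≥ wᵀ R w for all w ∈ W_symm. Equivalently, some rectangle window of odd length at least 3 minimizes the weighted least-squares smoothing objective G(w) = Σ_{n=1}^{N} Σ_{k=−K}^{K} w_k (y_{n+k} − Σ_m w_m y_{n+m})² over all tapered rectangle windows. -/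
/-- Cyclic autocorrelation `r t = ∑ n, y n * y (n + t)` of `y : ZMod (2K+1) → ℝ`. -/
noncomputable def autocorr (K : ℕ) (y : ZMod (2 * K + 1) → ℝ)
    (t : ZMod (2 * K + 1)) : ℝ :=
  ∑ n, y n * y (n + t)

/-- The quadratic form `wᵀ R w` for a window `w` indexed by `k ∈ {-K, …, K}`, where
`R (i,j) = r (j - i)` is the circulant autocorrelation matrix. -/
noncomputable def quadForm (K : ℕ) (y : ZMod (2 * K + 1) → ℝ) (w : ℤ → ℝ) : ℝ :=
  ∑ k ∈ Finset.Icc (-(K : ℤ)) (K : ℤ), ∑ m ∈ Finset.Icc (-(K : ℤ)) (K : ℤ),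
    w k * w m * autocorr K y ((m - k : ℤ) : ZMod (2 * K + 1))

/-- The set of tapered rectangle windows: simplex vectors indexed by `k ∈ {-K, …, K}`
(zero outside) with `w (-1) = w 0 = w 1`, symmetric `w (-k) = w k`, and nonincreasing
away from the center. -/
def Tapered (K : ℕ) : Set (ℤ → ℝ) :=
  {w | (∀ k, 0 ≤ w k) ∧ (∀ k : ℤ, (K : ℤ) < |k| → w k = 0) ∧
       (∑ k ∈ Finset.Icc (-(K : ℤ)) (K : ℤ), w k = 1) ∧
       (w (-1) = w 0 ∧ w 0 = w 1) ∧ (∀ k : ℤ, w (-k) = w k) ∧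
       (∀ k : ℤ, 1 ≤ k → w (k + 1) ≤ w k)}

/-- The uniform (rectangle) window of length `2i+1`:
`u_{i,k} = 1/(2i+1)` for `|k| ≤ i`, `0` otherwise. -/
noncomputable def unif (i k : ℤ) : ℝ :=
  if |k| ≤ i then 1 / (2 * (i : ℝ) + 1) else 0

/-- The weighted least-squares smoothing objective
`G w = ∑ n ∑ k w k (y (n+k) - ∑ m w m y (n+m))²` with cyclic indices. -/
noncomputable def smoothObj (K : ℕ) (y : ZMod (2 * K + 1) → ℝ) (w : ℤ → ℝ) : ℝ :=
  ∑ n : ZMod (2 * K + 1), ∑ k ∈ Finset.Icc (-(K : ℤ)) (K : ℤ),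
    w k * (y (n + (k : ZMod (2 * K + 1))) -
      ∑ m ∈ Finset.Icc (-(K : ℤ)) (K : ℤ), w m * y (n + (m : ZMod (2 * K + 1)))) ^ 2

/-- Expanding the cyclic autocorrelation turns `wᵀ R w` into the energy of the smoothed signal. -/
lemma quadForm_eq_sum_sq (K : ℕ) (y : ZMod (2 * K + 1) → ℝ) (w : ℤ → ℝ) :
    quadForm K y w = ∑ n : ZMod (2 * K + 1),
      (∑ m ∈ Finset.Icc (-(K : ℤ)) (K : ℤ), w m * y (n + (m : ZMod (2 * K + 1)))) ^ 2 := by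
  have shift (k m : ℤ) : autocorr K y ((m - k : ℤ) : ZMod (2 * K + 1)) =
      ∑ n, y (n + (k : ZMod (2 * K + 1))) * y (n + (m : ZMod (2 * K + 1))) := by
    rw [autocorr, ← Equiv.sum_comp (Equiv.addRight (k : ZMod (2 * K + 1)))]
    refine Finset.sum_congr rfl fun n _ => ?_
    simp only [Equiv.coe_addRight, Int.cast_sub, add_assoc, add_sub_cancel]
  simp only [quadForm, shift, Finset.mul_sum]
  rw [Finset.sum_comm_cycle]
  refine Finset.sum_congr rfl fun n _ => ?_
  rw [sq, Finset.sum_mul_sum, Finset.sum_comm]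
  exact Finset.sum_congr rfl fun k _ => Finset.sum_congr rfl fun m _ => by ring

/-- For weights of total mass one, the smoothing objective is the signal energy minus `wᵀ R w`. -/
lemma smoothObj_eq_sub_quadForm (K : ℕ) (y : ZMod (2 * K + 1) → ℝ) {w : ℤ → ℝ}
    (hw : ∑ k ∈ Finset.Icc (-(K : ℤ)) (K : ℤ), w k = 1) :
    smoothObj K y w = ∑ n, y n ^ 2 - quadForm K y w := by
  have energy : ∑ n : ZMod (2 * K + 1), ∑ k ∈ Finset.Icc (-(K : ℤ)) (K : ℤ),
      w k * y (n + (k : ZMod (2 * K + 1))) ^ 2 = ∑ n, y n ^ 2 := by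
    rw [Finset.sum_comm]
    have shift (k : ℤ) : ∑ n, y (n + (k : ZMod (2 * K + 1))) ^ 2 = ∑ n, y n ^ 2 :=
      Equiv.sum_comp (Equiv.addRight (k : ZMod (2 * K + 1))) fun n => y n ^ 2
    simp only [← Finset.mul_sum, shift]
    rw [← Finset.sum_mul, hw, one_mul]
  rw [quadForm_eq_sum_sq, ← energy, ← Finset.sum_sub_distrib]
  refine Finset.sum_congr rfl fun n _ => ?_
  set a := ∑ m ∈ Finset.Icc (-(K : ℤ)) (K : ℤ), w m * y (n + (m : ZMod (2 * K + 1))) with ha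
  calc ∑ k ∈ Finset.Icc (-(K : ℤ)) (K : ℤ), w k * (y (n + (k : ZMod (2 * K + 1))) - a) ^ 2
      = ∑ k ∈ Finset.Icc (-(K : ℤ)) (K : ℤ), (w k * y (n + (k : ZMod (2 * K + 1))) ^ 2
          - 2 * a * (w k * y (n + (k : ZMod (2 * K + 1)))) + w k * a ^ 2) :=
        Finset.sum_congr rfl fun k _ => by ring
    _ = ∑ k ∈ Finset.Icc (-(K : ℤ)) (K : ℤ), w k * y (n + (k : ZMod (2 * K + 1))) ^ 2
          - 2 * a * a + 1 * a ^ 2 := by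
        rw [Finset.sum_add_distrib, Finset.sum_sub_distrib, ← Finset.mul_sum, ← Finset.sum_mul,
          hw, ← ha]
    _ = _ := by ring

/-- The quadratic form of a circulant autocorrelation matrix satisfies Jensen's inequality. -/
lemma quadForm_sum_le {ι : Type*} (K : ℕ) (y : ZMod (2 * K + 1) → ℝ) (s : Finset ι)
    (c : ι → ℝ) (v : ι → ℤ → ℝ) (hc : ∀ i ∈ s, 0 ≤ c i) (hc1 : ∑ i ∈ s, c i = 1) :
    quadForm K y (fun k => ∑ i ∈ s, c i * v i k) ≤ ∑ i ∈ s, c i * quadForm K y (v i) := by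
  simp only [quadForm_eq_sum_sq, Finset.mul_sum]
  rw [Finset.sum_comm]
  refine Finset.sum_le_sum fun n _ => ?_
  have linear : ∑ m ∈ Finset.Icc (-(K : ℤ)) (K : ℤ),
      (∑ i ∈ s, c i * v i m) * y (n + (m : ZMod (2 * K + 1))) =
      ∑ i ∈ s, c i * ∑ m ∈ Finset.Icc (-(K : ℤ)) (K : ℤ),
        v i m * y (n + (m : ZMod (2 * K + 1))) := by
    simp only [Finset.sum_mul, Finset.mul_sum, mul_assoc]
    exact Finset.sum_comm
  rw [linear]
  exact (even_two.convexOn_pow (𝕜 := ℝ)).map_sum_le hc hc1 fun _ _ => Set.mem_univ _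

lemma sum_unif (K : ℕ) {i : ℤ} (hi : i ∈ Finset.Icc (1 : ℤ) K) :
    ∑ k ∈ Finset.Icc (-(K : ℤ)) (K : ℤ), unif i k = 1 := by
  obtain ⟨hi1, hiK⟩ := Finset.mem_Icc.mp hi
  have support : (Finset.Icc (-(K : ℤ)) (K : ℤ)).filter (fun k => |k| ≤ i) =
      Finset.Icc (-i) i := by
    ext k
    simp only [Finset.mem_filter, Finset.mem_Icc, abs_le]
    omega
  have hpos : (0 : ℝ) < 2 * (i : ℝ) + 1 := by
    have : (1 : ℝ) ≤ i := by exact_mod_cast hi1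
    linarith
  have card : ((Finset.Icc (-i) i).card : ℝ) = 2 * (i : ℝ) + 1 := by
    have : ((Finset.Icc (-i) i).card : ℤ) = 2 * i + 1 := by
      rw [Int.card_Icc]
      omega
    exact_mod_cast this
  simp only [unif]
  rw [← Finset.sum_filter, support, Finset.sum_const, nsmul_eq_mul, card]
  field_simp

/-- Telescoping over the indices `i ∈ {1, …, n}` with `k ≤ i`. -/
lemma sum_Icc_ite_sub (f : ℤ → ℝ) (k : ℤ) (n : ℕ) :
    ∑ i ∈ Finset.Icc (1 : ℤ) n, (if k ≤ i then f i - f (i + 1) else 0) =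
      f (max 1 k) - f (max (n + 1) k) := by
  induction n with
  | zero => simp
  | succ n ih =>
    have hIcc : Finset.Icc (1 : ℤ) ((n + 1 : ℕ) : ℤ) =
        insert ((n : ℤ) + 1) (Finset.Icc (1 : ℤ) n) := by
      ext j
      simp only [Finset.mem_insert, Finset.mem_Icc]
      omega
    rw [hIcc, Finset.sum_insert (by simp), ih]
    push_cast
    split_ifs with h
    · rw [max_eq_left h, max_eq_left (by omega : k ≤ (n : ℤ) + 1 + 1)]
      ring
    · rw [max_eq_right (by omega : (n : ℤ) + 1 ≤ k),
        max_eq_right (by omega : (n : ℤ) + 1 + 1 ≤ k)]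
      ring

/-- Every tapered rectangle window is a combination of uniform windows. -/
lemma eq_sum_unif_of_mem_tapered {K : ℕ} {w : ℤ → ℝ} (hw : w ∈ Tapered K) (k : ℤ) :
    w k = ∑ i ∈ Finset.Icc (1 : ℤ) K, (2 * (i : ℝ) + 1) * (w i - w (i + 1)) * unif i k := by
  obtain ⟨-, hsupp, -, ⟨-, h01⟩, hsymm, -⟩ := hw
  have term : ∀ i ∈ Finset.Icc (1 : ℤ) K,
      (2 * (i : ℝ) + 1) * (w i - w (i + 1)) * unif i k =
        if |k| ≤ i then w i - w (i + 1) else 0 := by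
    intro i hi
    have : (1 : ℝ) ≤ i := by exact_mod_cast (Finset.mem_Icc.mp hi).1
    rw [unif]
    split_ifs
    · field_simp
    · simp
  have habs : w |k| = w k := by
    rcases abs_choice k with h | h <;> rw [h]
    exact hsymm k
  have hmax : w (max 1 |k|) = w k := by
    rcases eq_or_ne k 0 with rfl | hk
    · simp [h01]
    · rw [max_eq_right (Int.one_le_abs hk), habs]
  rw [Finset.sum_congr rfl term, sum_Icc_ite_sub, hmax, hsupp (max (K + 1) |k|), sub_zero]
  exact (lt_of_lt_of_le (by omega) (le_max_left _ _)).trans_le (le_abs_self _)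

/-- some uniform moving-average window `u_i` of odd length `2i+1 ≥ 3`
maximizes the quadratic form `wᵀ R w` over all tapered rectangle windows; equivalently,
it minimizes the weighted least-squares smoothing objective over them. -/
theorem best_rectangle_window_optimal_least_squares
    (K : ℕ) (hK : 1 ≤ K) (y : ZMod (2 * K + 1) → ℝ) :
    ∃ i ∈ Finset.Icc (1 : ℤ) (K : ℤ),
      (∀ w ∈ Tapered K, quadForm K y w ≤ quadForm K y (unif i)) ∧
      (∀ w ∈ Tapered K, smoothObj K y (unif i) ≤ smoothObj K y w) := by
  obtain ⟨i, hi, hmax⟩ := (Finset.Icc (1 : ℤ) K).exists_max_image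
    (fun i => quadForm K y (unif i)) ⟨1, by simpa using hK⟩
  have hquad : ∀ w ∈ Tapered K, quadForm K y w ≤ quadForm K y (unif i) := by
    intro w hw
    have hdecomp := eq_sum_unif_of_mem_tapered hw
    obtain ⟨-, -, hsum, -, -, hanti⟩ := hw
    set c : ℤ → ℝ := fun j => (2 * (j : ℝ) + 1) * (w j - w (j + 1))
    have hc0 : ∀ j ∈ Finset.Icc (1 : ℤ) K, 0 ≤ c j := by
      intro j hj
      have hj1 := (Finset.mem_Icc.mp hj).1
      have : (1 : ℝ) ≤ j := by exact_mod_cast hj1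
      exact mul_nonneg (by linarith) (sub_nonneg.mpr (hanti j hj1))
    have hc1 : ∑ j ∈ Finset.Icc (1 : ℤ) K, c j = 1 := by
      rw [← hsum, Finset.sum_congr rfl fun k _ => hdecomp k, Finset.sum_comm]
      refine Finset.sum_congr rfl fun j hj => ?_
      rw [← Finset.mul_sum, sum_unif K hj, mul_one]
    calc quadForm K y w
        = quadForm K y (fun k => ∑ j ∈ Finset.Icc (1 : ℤ) K, c j * unif j k) :=
          congrArg _ (funext hdecomp)
      _ ≤ ∑ j ∈ Finset.Icc (1 : ℤ) K, c j * quadForm K y (unif j) :=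
          quadForm_sum_le K y _ c unif hc0 hc1
      _ ≤ ∑ j ∈ Finset.Icc (1 : ℤ) K, c j * quadForm K y (unif i) :=
          Finset.sum_le_sum fun j hj => mul_le_mul_of_nonneg_left (hmax j hj) (hc0 j hj)
      _ = quadForm K y (unif i) := by rw [← Finset.sum_mul, hc1, one_mul]
  refine ⟨i, hi, hquad, fun w hw => ?_⟩
  rw [smoothObj_eq_sub_quadForm K y (sum_unif K hi), smoothObj_eq_sub_quadForm K y hw.2.2.1]
  exact sub_le_sub_left (hquad w hw) _
end
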